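/- arXiv:1407.3978 — 8 statements merged into one kernel-verified Lean document; each statement's English description precedes it below -/
import Mathlib

section
/- Let T be a Leibniz triple system over a field K of characteristic 0. Then for all a, b, c, d, e ∈ T the following identities hold: (i) {a{bcd}e} + {a{cbd}e} = 0 and {ab{cde}} + {ab{dce}} = 0; (ii) {a{bcd}e} + {a{cdb}e} + {a{dbc}e} = 0 and {ab{cde}} + {ab{dec}} + {ab{ecd}} = 0; (iii) {{cde}ba} − {{cde}ab} − {{cba}de} + {{cab}de} − {c{abd}e} − {cd{abe}} = 0. -/
open TensorProduct

noncomputable section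

variable {K : Type*} [Field K] [CharZero K]
variable {T : Type*} [AddCommGroup T] [Module K T]

/-- First defining identity of a Leibniz triple system:
`{a{bcd}e} = {{abc}de} − {{acb}de} − {{adb}ce} + {{adc}be}`. -/
def LTS1 (t : T →ₗ[K] T →ₗ[K] T →ₗ[K] T) : Prop :=
  ∀ a b c d e : T,
    t a (t b c d) e =
      t (t a b c) d e - t (t a c b) d e - t (t a d b) c e + t (t a d c) b e

/-- Second defining identity of a Leibniz triple system:
`{ab{cde}} = {{abc}de} − {{abd}ce} − {{abe}cd} + {{abe}dc}`. -/
def LTS2 (t : T →ₗ[K] T →ₗ[K] T →ₗ[K] T) : Prop :=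
  ∀ a b c d e : T,
    t a b (t c d e) =
      t (t a b c) d e - t (t a b d) c e - t (t a b e) c d + t (t a b e) d c

/-- The axioms of a Lie triple system. -/
def IsLieTS (t : T →ₗ[K] T →ₗ[K] T →ₗ[K] T) : Prop :=
  (∀ a c : T, t a a c = 0) ∧
  (∀ a b c : T, t a b c + t b c a + t c a b = 0) ∧
  (∀ a b c d e : T,
    t a b (t c d e) = t (t a b c) d e + t c (t a b d) e + t c d (t a b e))

/-- The bracket of the universal Leibniz envelope `U(T) = T ⊕ (T ⊗ T)`,
determined by `[a,b] = a⊗b`, `[a⊗b,c] = {abc}`, `[a,b⊗c] = {abc} − {acb}`,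
`[a⊗b,c⊗d] = {abc}⊗d − {abd}⊗c`. -/
def bkt (t : T →ₗ[K] T →ₗ[K] T →ₗ[K] T) (x y : T × (T ⊗[K] T)) :
    T × (T ⊗[K] T) :=
  (TensorProduct.lift t x.2 y.1
      + TensorProduct.lift (t x.1) y.2 - TensorProduct.lift ((t x.1).flip) y.2,
   x.1 ⊗ₜ[K] y.1
      + LinearMap.rTensor T (TensorProduct.lift t x.2) y.2
      - LinearMap.rTensor T (TensorProduct.lift t x.2) (TensorProduct.comm K T T y.2))

/-- The induced bracket on the subalgebra `T ⊗ T` of `U(T)`. -/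
def bktT (t : T →ₗ[K] T →ₗ[K] T →ₗ[K] T) (w w' : T ⊗[K] T) : T ⊗[K] T :=
  LinearMap.rTensor T (TensorProduct.lift t w) w'
    - LinearMap.rTensor T (TensorProduct.lift t w) (TensorProduct.comm K T T w')

/-- `{ABC}`: the span of all products `{abc}` with `a ∈ A`, `b ∈ B`, `c ∈ C`. -/
def tspan (t : T →ₗ[K] T →ₗ[K] T →ₗ[K] T) (A B C : Submodule K T) : Submodule K T :=
  Submodule.span K {x | ∃ a ∈ A, ∃ b ∈ B, ∃ c ∈ C, x = t a b c}

/-- `I` is an ideal of the Leibniz triple system `(T, t)`. -/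
def IsIdealT (t : T →ₗ[K] T →ₗ[K] T →ₗ[K] T) (I : Submodule K T) : Prop :=
  ∀ x ∈ I, ∀ a b : T, t x a b ∈ I ∧ t a x b ∈ I ∧ t a b x ∈ I

/-- `i(I) = I ⊗ T + T ⊗ I` as a subspace of `T ⊗ T`. -/
def iI (I : Submodule K T) : Submodule K (T ⊗[K] T) :=
  Submodule.span K
    {z | (∃ x ∈ I, ∃ a : T, z = x ⊗ₜ[K] a) ∨ (∃ x ∈ I, ∃ a : T, z = a ⊗ₜ[K] x)}

/-- `j(I) = {w ∈ T⊗T | [w, T] + [T, w] ⊆ I}`. -/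
def jI (t : T →ₗ[K] T →ₗ[K] T →ₗ[K] T) (I : Submodule K T) : Submodule K (T ⊗[K] T) :=
  ⨅ a : T,
    Submodule.comap ((TensorProduct.lift t).flip a) I ⊓
      Submodule.comap (TensorProduct.lift (t a) - TensorProduct.lift ((t a).flip)) I

/-- `𝕀(I) = I + i(I)` as a subspace of `U(T)`. -/
def IU (I : Submodule K T) : Submodule K (T × (T ⊗[K] T)) := I.prod (iI I)

/-- `𝕁(I) = I + j(I)` as a subspace of `U(T)`. -/
def JU (t : T →ₗ[K] T →ₗ[K] T →ₗ[K] T) (I : Submodule K T) :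
    Submodule K (T × (T ⊗[K] T)) := I.prod (jI t I)

/-- `V` is an ideal of the Leibniz algebra `T ⊗ T`. -/
def IsIdealTT (t : T →ₗ[K] T →ₗ[K] T →ₗ[K] T) (V : Submodule K (T ⊗[K] T)) : Prop :=
  ∀ v ∈ V, ∀ w : T ⊗[K] T, bktT t v w ∈ V ∧ bktT t w v ∈ V

/-- `V` is an ideal of the Leibniz algebra `U(T)`. -/
def IsIdealU (t : T →ₗ[K] T →ₗ[K] T →ₗ[K] T) (V : Submodule K (T × (T ⊗[K] T))) : Prop :=
  ∀ v ∈ V, ∀ x : T × (T ⊗[K] T), bkt t v x ∈ V ∧ bkt t x v ∈ V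

/-- The derived series of `I` relative to an ambient subsystem `S`:
`I⁰ = I`, `Iⁿ⁺¹ = {S Iⁿ Iⁿ} + {Iⁿ S Iⁿ} + {Iⁿ Iⁿ S}`. -/
def derRel (t : T →ₗ[K] T →ₗ[K] T →ₗ[K] T) (S I : Submodule K T) : ℕ → Submodule K T
  | 0 => I
  | n + 1 =>
      tspan t S (derRel t S I n) (derRel t S I n) ⊔
        tspan t (derRel t S I n) S (derRel t S I n) ⊔
          tspan t (derRel t S I n) (derRel t S I n) S

/-- The derived series `I^[n]` of an ideal `I` of `T`:
`I^[0] = I`, `I^[n+1] = {T I^[n] I^[n]} + {I^[n] T I^[n]} + {I^[n] I^[n] T}`. -/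
def derT (t : T →ₗ[K] T →ₗ[K] T →ₗ[K] T) (I : Submodule K T) : ℕ → Submodule K T :=
  derRel t ⊤ I

/-- `I` is a solvable ideal of the Leibniz triple system `T`. -/
def IsSolvT (t : T →ₗ[K] T →ₗ[K] T →ₗ[K] T) (I : Submodule K T) : Prop :=
  ∃ k, derT t I k = ⊥

/-- The span of all brackets `[x, y]`, `x ∈ A`, `y ∈ B`, in `U(T)`. -/
def bspan (t : T →ₗ[K] T →ₗ[K] T →ₗ[K] T) (A B : Submodule K (T × (T ⊗[K] T))) :
    Submodule K (T × (T ⊗[K] T)) :=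
  Submodule.span K {z | ∃ x ∈ A, ∃ y ∈ B, z = bkt t x y}

/-- The derived series of a subspace `V` of the Leibniz algebra `U(T)`. -/
def derU (t : T →ₗ[K] T →ₗ[K] T →ₗ[K] T) (V : Submodule K (T × (T ⊗[K] T))) :
    ℕ → Submodule K (T × (T ⊗[K] T))
  | 0 => V
  | n + 1 => bspan t (derU t V n) (derU t V n)

/-- `V` is a solvable subspace of the Leibniz algebra `U(T)`. -/
def IsSolvU (t : T →ₗ[K] T →ₗ[K] T →ₗ[K] T) (V : Submodule K (T × (T ⊗[K] T))) : Prop :=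
  ∃ k, derU t V k = ⊥

/-- The solvable radical `R(T)`: the sum of all solvable ideals of `T`. -/
def radT (t : T →ₗ[K] T →ₗ[K] T →ₗ[K] T) : Submodule K T :=
  sSup {S : Submodule K T | IsIdealT t S ∧ IsSolvT t S}

/-- The solvable radical `Rad(U(T))`: the sum of all solvable ideals of `U(T)`. -/
def radU (t : T →ₗ[K] T →ₗ[K] T →ₗ[K] T) : Submodule K (T × (T ⊗[K] T)) :=
  sSup {V : Submodule K (T × (T ⊗[K] T)) | IsIdealU t V ∧ IsSolvU t V}

/-- `Ker(T)`: the span of all `{abc} − {acb} + {bca}`. -/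
def kerT (t : T →ₗ[K] T →ₗ[K] T →ₗ[K] T) : Submodule K T :=
  Submodule.span K {x | ∃ a b c : T, x = t a b c - t a c b + t b c a}

/-- `Ker(U(T))`: the span of all `[x, x]`, `x ∈ U(T)`. -/
def kerU (t : T →ₗ[K] T →ₗ[K] T →ₗ[K] T) : Submodule K (T × (T ⊗[K] T)) :=
  Submodule.span K {z | ∃ x : T × (T ⊗[K] T), z = bkt t x x}

/-- The central lower sequence of an ideal `I` of `T`: `I⁰ = I`,
`Iᵐ⁺¹ = {Iᵐ I T} + {Iᵐ T I} + {I Iᵐ T} + {I T Iᵐ} + {T I Iᵐ} + {T Iᵐ I}`. -/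
def clsT (t : T →ₗ[K] T →ₗ[K] T →ₗ[K] T) (I : Submodule K T) : ℕ → Submodule K T
  | 0 => I
  | m + 1 =>
      tspan t (clsT t I m) I ⊤ ⊔ tspan t (clsT t I m) ⊤ I ⊔
        tspan t I (clsT t I m) ⊤ ⊔ tspan t I ⊤ (clsT t I m) ⊔
          tspan t ⊤ I (clsT t I m) ⊔ tspan t ⊤ (clsT t I m) I

/-- `I` is a nilpotent ideal of the Leibniz triple system `T`. -/
def IsNilT (t : T →ₗ[K] T →ₗ[K] T →ₗ[K] T) (I : Submodule K T) : Prop :=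
  ∃ n, clsT t I n = ⊥

/-- The lower central series of a subspace `V` of the Leibniz algebra `U(T)`:
`V⁰ = V`, `Vᵐ⁺¹ = [Vᵐ, V]`. -/
def clsU (t : T →ₗ[K] T →ₗ[K] T →ₗ[K] T) (V : Submodule K (T × (T ⊗[K] T))) :
    ℕ → Submodule K (T × (T ⊗[K] T))
  | 0 => V
  | m + 1 => bspan t (clsU t V m) V

/-- `V` is a nilpotent subspace of the Leibniz algebra `U(T)`. -/
def IsNilU (t : T →ₗ[K] T →ₗ[K] T →ₗ[K] T) (V : Submodule K (T × (T ⊗[K] T))) : Prop :=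
  ∃ n, clsU t V n = ⊥

/-- `Tⁿ`: the lower central series of `T`, `T⁰ = T`,
`Tⁿ⁺¹ = {Tⁿ T T} + {T Tⁿ T} + {T T Tⁿ}`. -/
def lcsT (t : T →ₗ[K] T →ₗ[K] T →ₗ[K] T) : ℕ → Submodule K T
  | 0 => ⊤
  | n + 1 => tspan t (lcsT t n) ⊤ ⊤ ⊔ tspan t ⊤ (lcsT t n) ⊤ ⊔ tspan t ⊤ ⊤ (lcsT t n)

/-- `T⁽ⁿ⁾`: `T⁽⁰⁾ = T`, `T⁽ⁿ⁺¹⁾ = {T⁽ⁿ⁾ T T}`. -/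
def powT (t : T →ₗ[K] T →ₗ[K] T →ₗ[K] T) : ℕ → Submodule K T
  | 0 => ⊤
  | n + 1 => tspan t (powT t n) ⊤ ⊤


/-- Derived identities of a Leibniz triple system: the two "comm" identities,
the two cyclic identities, and identity (VIP3). -/
theorem leibniz_triple_system_derived_identities
    (t : T →ₗ[K] T →ₗ[K] T →ₗ[K] T) (h1 : LTS1 t) (h2 : LTS2 t) :
    (∀ a b c d e : T, t a (t b c d) e + t a (t c b d) e = 0) ∧
    (∀ a b c d e : T, t a b (t c d e) + t a b (t d c e) = 0) ∧
    (∀ a b c d e : T, t a (t b c d) e + t a (t c d b) e + t a (t d b c) e = 0) ∧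
    (∀ a b c d e : T, t a b (t c d e) + t a b (t d e c) + t a b (t e c d) = 0) ∧
    (∀ a b c d e : T,
      t (t c d e) b a - t (t c d e) a b - t (t c b a) d e + t (t c a b) d e
        - t c (t a b d) e - t c d (t a b e) = 0) := by
  refine ⟨?_, ?_, ?_, ?_, ?_⟩ <;> intro a b c d e
  · rw [h1 a b c d e, h1 a c b d e]
    abel
  · rw [h2 a b c d e, h2 a b d c e]
    abel
  · rw [h1 a b c d e, h1 a c d b e, h1 a d b c e]
    abel
  · rw [h2 a b c d e, h2 a b d e c, h2 a b e c d]
    abel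
  · rw [h1 c a b d e, h2 c d a b e]
    abel

end
end

section
/- Let T be a Leibniz triple system over a field K of characteristic 0 with universal Leibniz envelope U(T), and let I be an ideal of T. Then: (1) i(I) ⊆ j(I) and 𝕀(I) ⊆ 𝕁(I); (2) i(I) and j(I) are ideals of the Leibniz algebra T ⊗ T; (3) 𝕀(I) and 𝕁(I) are ideals of the Leibniz algebra U(T). -/
open TensorProduct

noncomputable section

variable {K : Type*} [Field K] [CharZero K]
variable {T : Type*} [AddCommGroup T] [Module K T]

section

omit [CharZero K]

variable {t : T →ₗ[K] T →ₗ[K] T →ₗ[K] T} {I : Submodule K T}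

theorem mem_jI {w : T ⊗[K] T} :
    w ∈ jI t I ↔ ∀ a : T, TensorProduct.lift t w a ∈ I ∧
      TensorProduct.lift (t a) w - TensorProduct.lift ((t a).flip) w ∈ I := by
  simp [jI, Submodule.mem_iInf]

theorem tmul_mem_iI_left {x : T} (hx : x ∈ I) (a : T) : x ⊗ₜ[K] a ∈ iI I :=
  Submodule.subset_span (Or.inl ⟨x, hx, a, rfl⟩)

theorem tmul_mem_iI_right {x : T} (hx : x ∈ I) (a : T) : a ⊗ₜ[K] x ∈ iI I :=
  Submodule.subset_span (Or.inr ⟨x, hx, a, rfl⟩)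

theorem bktT_tmul (w : T ⊗[K] T) (c d : T) :
    bktT t w (c ⊗ₜ d) =
      TensorProduct.lift t w c ⊗ₜ d - TensorProduct.lift t w d ⊗ₜ c := by
  simp [bktT]

theorem bktT_add_right (w u v : T ⊗[K] T) : bktT t w (u + v) = bktT t w u + bktT t w v := by
  simp only [bktT, map_add]; abel

theorem bktT_add_left (w u v : T ⊗[K] T) : bktT t (w + u) v = bktT t w v + bktT t u v := by
  simp only [bktT, map_add, LinearMap.rTensor_add, LinearMap.add_apply]; abel

theorem bktT_smul_right (r : K) (w u : T ⊗[K] T) : bktT t w (r • u) = r • bktT t w u := by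
  simp only [bktT, map_smul, smul_sub]

theorem bktT_zero_right (w : T ⊗[K] T) : bktT t w 0 = 0 := by
  simp [bktT]

theorem bktT_zero_left (w : T ⊗[K] T) : bktT t 0 w = 0 := by
  simp [bktT]

/-- The right Leibniz identity `[w, [v, a]] = [[w, v], a] - [[w, a], v]` in `U(T)`. -/
theorem lift_bktT_apply (h2 : LTS2 t) (w v : T ⊗[K] T) (a : T) :
    TensorProduct.lift t (bktT t w v) a =
      TensorProduct.lift t w (TensorProduct.lift t v a) +
        (TensorProduct.lift (t (TensorProduct.lift t w a)) v -
          TensorProduct.lift ((t (TensorProduct.lift t w a)).flip) v) := by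
  induction v with
  | zero => simp [bktT_zero_right]
  | add v₁ v₂ ih₁ ih₂ =>
    simp only [bktT_add_right, map_add, LinearMap.add_apply, ih₁, ih₂]; abel
  | tmul x y =>
    rw [bktT_tmul]
    induction w with
    | zero => simp
    | add w₁ w₂ ih₁ ih₂ =>
      simp only [map_add, map_sub, LinearMap.add_apply, LinearMap.sub_apply, lift.tmul,
        LinearMap.flip_apply] at ih₁ ih₂ ⊢
      linear_combination (norm := module) ih₁ + ih₂
    | tmul c d =>
      simp only [map_sub, LinearMap.sub_apply, lift.tmul, LinearMap.flip_apply, h2 c d x y a]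
      abel

/-- The right Leibniz identity `[a, [w, v]] = [[a, w], v] - [[a, v], w]` in `U(T)`. -/
theorem lift_apply_bktT (h1 : LTS1 t) (h2 : LTS2 t) (w v : T ⊗[K] T) (a : T) :
    TensorProduct.lift (t a) (bktT t w v) - TensorProduct.lift ((t a).flip) (bktT t w v) =
      (TensorProduct.lift
          (t (TensorProduct.lift (t a) w - TensorProduct.lift ((t a).flip) w)) v -
        TensorProduct.lift
          ((t (TensorProduct.lift (t a) w - TensorProduct.lift ((t a).flip) w)).flip) v) -
      (TensorProduct.lift
          (t (TensorProduct.lift (t a) v - TensorProduct.lift ((t a).flip) v)) w -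
        TensorProduct.lift
          ((t (TensorProduct.lift (t a) v - TensorProduct.lift ((t a).flip) v)).flip) w) := by
  have lift_add (f g : T →ₗ[K] T →ₗ[K] T) (u : T ⊗[K] T) :
      TensorProduct.lift (f + g) u = TensorProduct.lift f u + TensorProduct.lift g u := by
    induction u with
    | zero => simp
    | add u₁ u₂ ih₁ ih₂ => simp only [map_add, ih₁, ih₂]; abel
    | tmul => simp
  have lift_sub (f g : T →ₗ[K] T →ₗ[K] T) (u : T ⊗[K] T) :
      TensorProduct.lift (f - g) u = TensorProduct.lift f u - TensorProduct.lift g u := by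
    rw [eq_sub_iff_add_eq, ← lift_add, sub_add_cancel]
  have lift_zero (u : T ⊗[K] T) : TensorProduct.lift (0 : T →ₗ[K] T →ₗ[K] T) u = 0 := by
    simpa using lift_sub 0 0 u
  have flip_zero : (0 : T →ₗ[K] T →ₗ[K] T).flip = 0 := rfl
  have flip_add (f g : T →ₗ[K] T →ₗ[K] T) : (f + g).flip = f.flip + g.flip := rfl
  have flip_sub (f g : T →ₗ[K] T →ₗ[K] T) : (f - g).flip = f.flip - g.flip := rfl
  induction v with
  | zero => simp [bktT_zero_right, lift_zero, flip_zero]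
  | add v₁ v₂ ih₁ ih₂ =>
    simp only [bktT_add_right, map_add, map_sub, lift_add, lift_sub, flip_add, flip_sub]
      at ih₁ ih₂ ⊢
    linear_combination (norm := module) ih₁ + ih₂
  | tmul x y =>
    induction w with
    | zero => simp [bktT_zero_left]
    | add w₁ w₂ ih₁ ih₂ =>
      simp only [bktT_add_left, map_add, map_sub, lift_add, lift_sub, flip_add, flip_sub]
        at ih₁ ih₂ ⊢
      linear_combination (norm := module) ih₁ + ih₂
    | tmul c d =>
      simp only [bktT_tmul, map_sub, LinearMap.sub_apply, lift.tmul, LinearMap.flip_apply,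
        h1 a c d x y, h1 a c d y x, h2 a x c d y, h2 a y c d x]
      abel

theorem iI_le_jI (hI : IsIdealT t I) : iI I ≤ jI t I := by
  refine Submodule.span_le.2 ?_
  rintro _ (⟨x, hx, b, rfl⟩ | ⟨x, hx, b, rfl⟩) <;> refine mem_jI.2 fun a => ?_
  · simpa using ⟨(hI x hx b a).1, I.sub_mem (hI x hx a b).2.1 (hI x hx a b).2.2⟩
  · simpa using ⟨(hI x hx b a).2.1, I.sub_mem (hI x hx a b).2.2 (hI x hx a b).2.1⟩

theorem lift_apply_mem (hI : IsIdealT t I) (w : T ⊗[K] T) {x : T} (hx : x ∈ I) :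
    TensorProduct.lift t w x ∈ I := by
  induction w with
  | zero => simp
  | add w₁ w₂ ih₁ ih₂ => simpa using I.add_mem ih₁ ih₂
  | tmul a b => simpa using (hI x hx a b).2.2

theorem lift_sub_lift_flip_mem (hI : IsIdealT t I) (w : T ⊗[K] T) {x : T} (hx : x ∈ I) :
    TensorProduct.lift (t x) w - TensorProduct.lift ((t x).flip) w ∈ I := by
  induction w with
  | zero => simp
  | add w₁ w₂ ih₁ ih₂ =>
    simp only [map_add, add_sub_add_comm]
    exact I.add_mem ih₁ ih₂
  | tmul a b => simpa using I.sub_mem (hI x hx a b).1 (hI x hx b a).1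

theorem bktT_mem_iI_of_mem_jI {v : T ⊗[K] T} (hv : v ∈ jI t I) (w : T ⊗[K] T) :
    bktT t v w ∈ iI I := by
  induction w with
  | zero => simp [bktT_zero_right]
  | add w₁ w₂ ih₁ ih₂ => simpa [bktT_add_right] using Submodule.add_mem _ ih₁ ih₂
  | tmul c d =>
    rw [bktT_tmul]
    exact Submodule.sub_mem _ (tmul_mem_iI_left (mem_jI.1 hv c).1 d)
      (tmul_mem_iI_left (mem_jI.1 hv d).1 c)

theorem isIdealTT_iI (hI : IsIdealT t I) : IsIdealTT t (iI I) := by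
  refine fun v hv w => ⟨bktT_mem_iI_of_mem_jI (iI_le_jI hI hv) w, ?_⟩
  induction hv using Submodule.span_induction with
  | mem z hz =>
    obtain ⟨x, hx, a, rfl⟩ | ⟨x, hx, a, rfl⟩ := hz <;> rw [bktT_tmul]
    · exact Submodule.sub_mem _ (tmul_mem_iI_left (lift_apply_mem hI w hx) a)
        (tmul_mem_iI_right hx _)
    · exact Submodule.sub_mem _ (tmul_mem_iI_right hx _)
        (tmul_mem_iI_left (lift_apply_mem hI w hx) a)
  | zero => simp [bktT_zero_right]
  | add u v _ _ ihu ihv => simpa [bktT_add_right] using Submodule.add_mem _ ihu ihv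
  | smul r u _ ih => simpa [bktT_smul_right] using Submodule.smul_mem _ r ih

theorem isIdealTT_jI (h1 : LTS1 t) (h2 : LTS2 t) (hI : IsIdealT t I) :
    IsIdealTT t (jI t I) := by
  refine fun v hv w => ⟨iI_le_jI hI (bktT_mem_iI_of_mem_jI hv w), mem_jI.2 fun a => ⟨?_, ?_⟩⟩
  · rw [lift_bktT_apply h2]
    exact I.add_mem (lift_apply_mem hI w (mem_jI.1 hv a).1) (mem_jI.1 hv _).2
  · rw [lift_apply_bktT h1 h2]
    exact I.sub_mem (mem_jI.1 hv _).2 (lift_sub_lift_flip_mem hI w (mem_jI.1 hv a).2)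

theorem bkt_eq (x y : T × (T ⊗[K] T)) :
    bkt t x y =
      (TensorProduct.lift t x.2 y.1 +
        (TensorProduct.lift (t x.1) y.2 - TensorProduct.lift ((t x.1).flip) y.2),
        x.1 ⊗ₜ[K] y.1 + bktT t x.2 y.2) := by
  simp only [bkt, bktT, add_sub_assoc]

/-- If `V` is an ideal of `T ⊗ T` with `i(I) ⊆ V ⊆ j(I)`, then `I + V` is an ideal of `U(T)`. -/
theorem isIdealU_prod (hI : IsIdealT t I) {V : Submodule K (T ⊗[K] T)} (hV : IsIdealTT t V)
    (hiV : iI I ≤ V) (hVj : V ≤ jI t I) : IsIdealU t (I.prod V) := by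
  rintro ⟨x, v⟩ ⟨hx, hv⟩ ⟨b, w⟩
  have hj := mem_jI.1 (hVj hv) b
  rw [bkt_eq, bkt_eq]
  exact ⟨⟨I.add_mem hj.1 (lift_sub_lift_flip_mem hI w hx),
      V.add_mem (hiV (tmul_mem_iI_left hx b)) (hV v hv w).1⟩,
    ⟨I.add_mem (lift_apply_mem hI w hx) hj.2,
      V.add_mem (hiV (tmul_mem_iI_right hx b)) (hV v hv w).2⟩⟩

end


/-- For an ideal `I` of a Leibniz triple system `T`:
(1) `i(I) ⊆ j(I)` and `𝕀(I) ⊆ 𝕁(I)`;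
(2) `i(I)` and `j(I)` are ideals of the Leibniz algebra `T ⊗ T`;
(3) `𝕀(I)` and `𝕁(I)` are ideals of the Leibniz algebra `U(T)`. -/
theorem ideals_of_universal_envelope
    (t : T →ₗ[K] T →ₗ[K] T →ₗ[K] T) (h1 : LTS1 t) (h2 : LTS2 t)
    (I : Submodule K T) (hI : IsIdealT t I) :
    (iI I ≤ jI t I ∧ IU I ≤ JU t I) ∧
    (IsIdealTT t (iI I) ∧ IsIdealTT t (jI t I)) ∧
    (IsIdealU t (IU I) ∧ IsIdealU t (JU t I)) := by
  have hij := iI_le_jI hI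
  have hi := isIdealTT_iI hI
  have hj := isIdealTT_jI h1 h2 hI
  exact ⟨⟨hij, Submodule.prod_mono le_rfl hij⟩, ⟨hi, hj⟩,
    isIdealU_prod hI hi le_rfl hij, isIdealU_prod hI hj hij le_rfl⟩

end
end

section
/- Let T be a Leibniz triple system over a field K of characteristic 0 and U(T) its universal Leibniz envelope. Then there is a unique involutive automorphism θ of the Leibniz algebra U(T) (a K-linear bijection preserving the bracket with θ² = id) such that T = { x ∈ U(T) : θ(x) = −x }. Explicitly, θ(a + w) = −a + w for a ∈ T and w ∈ T ⊗ T. -/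
open TensorProduct

noncomputable section

variable {K : Type*} [Field K] [CharZero K]
variable {T : Type*} [AddCommGroup T] [Module K T]

/-- The grading involution `a + w ↦ −a + w` of `U(T)`. -/
def gradingInvolution (K : Type*) [Field K] (T : Type*) [AddCommGroup T] [Module K T] :
    (T × (T ⊗[K] T)) ≃ₗ[K] (T × (T ⊗[K] T)) :=
  (LinearEquiv.neg K).prodCongr (LinearEquiv.refl K (T ⊗[K] T))

omit [CharZero K] in
theorem gradingInvolution_apply (x : T × (T ⊗[K] T)) :
    gradingInvolution K T x = (-x.1, x.2) := rfl

omit [CharZero K] in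
theorem gradingInvolution_bkt (t : T →ₗ[K] T →ₗ[K] T →ₗ[K] T) (x y : T × (T ⊗[K] T)) :
    gradingInvolution K T (bkt t x y) =
      bkt t (gradingInvolution K T x) (gradingInvolution K T y) := by
  have lift_neg (f : T →ₗ[K] T →ₗ[K] T) : lift (-f) = -lift f := by
    ext; simp
  have flip_neg (f : T →ₗ[K] T →ₗ[K] T) : (-f).flip = -f.flip := rfl
  simp only [gradingInvolution_apply, bkt, map_neg, lift_neg, flip_neg, LinearMap.neg_apply,
    TensorProduct.neg_tmul, TensorProduct.tmul_neg, neg_neg, Prod.mk.injEq, and_true]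
  abel

omit [CharZero K] in
theorem bkt_inl_inl (t : T →ₗ[K] T →ₗ[K] T →ₗ[K] T) (a b : T) :
    bkt t (a, 0) (b, 0) = (0, a ⊗ₜ[K] b) := by
  simp [bkt]

omit [CharZero K] in
/-- A linear map preserving the bracket of `U(T)` and negating `T` fixes `T ⊗ T`. -/
theorem apply_of_bkt_of_neg (t : T →ₗ[K] T →ₗ[K] T →ₗ[K] T)
    (θ : (T × (T ⊗[K] T)) →ₗ[K] (T × (T ⊗[K] T)))
    (hb : ∀ x y, θ (bkt t x y) = bkt t (θ x) (θ y)) (hT : ∀ a : T, θ (a, 0) = (-a, 0))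
    (a : T) (w : T ⊗[K] T) : θ (a, w) = (-a, w) := by
  have hw : θ ∘ₗ LinearMap.inr K T (T ⊗[K] T) = LinearMap.inr K T (T ⊗[K] T) := by
    refine TensorProduct.ext' fun b c => ?_
    have h := hb (b, 0) (c, 0)
    rw [hT, hT, bkt_inl_inl, bkt_inl_inl, TensorProduct.neg_tmul, TensorProduct.tmul_neg,
      neg_neg] at h
    exact h
  have hw' : θ (0, w) = (0, w) := LinearMap.congr_fun hw w
  have hadd : ((a, w) : T × (T ⊗[K] T)) = (a, 0) + (0, w) := by simp
  rw [hadd, map_add, hT, hw']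
  simp

/-- There is a unique involutive automorphism `θ` of `U(T)` with
`T = {x ∈ U(T) | θ(x) = −x}`; explicitly `θ(a + w) = −a + w`. -/
theorem involutive_automorphism_determining_T
    (t : T →ₗ[K] T →ₗ[K] T →ₗ[K] T) (h1 : LTS1 t) (h2 : LTS2 t) :
    (∃! θ : (T × (T ⊗[K] T)) ≃ₗ[K] (T × (T ⊗[K] T)),
      (∀ x y, θ (bkt t x y) = bkt t (θ x) (θ y)) ∧
      (∀ x, θ (θ x) = x) ∧
      {x : T × (T ⊗[K] T) | θ x = -x} = {x : T × (T ⊗[K] T) | x.2 = 0}) ∧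
    (∀ θ : (T × (T ⊗[K] T)) ≃ₗ[K] (T × (T ⊗[K] T)),
      ((∀ x y, θ (bkt t x y) = bkt t (θ x) (θ y)) ∧
        (∀ x, θ (θ x) = x) ∧
        {x : T × (T ⊗[K] T) | θ x = -x} = {x : T × (T ⊗[K] T) | x.2 = 0}) →
      ∀ (a : T) (w : T ⊗[K] T), θ (a, w) = (-a, w)) := by
  have key : ∀ θ : (T × (T ⊗[K] T)) ≃ₗ[K] (T × (T ⊗[K] T)),
      ((∀ x y, θ (bkt t x y) = bkt t (θ x) (θ y)) ∧
        (∀ x, θ (θ x) = x) ∧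
        {x : T × (T ⊗[K] T) | θ x = -x} = {x : T × (T ⊗[K] T) | x.2 = 0}) →
      ∀ (a : T) (w : T ⊗[K] T), θ (a, w) = (-a, w) := by
    rintro θ ⟨hb, -, hT⟩
    refine apply_of_bkt_of_neg t θ.toLinearMap hb fun a => ?_
    have h : θ (a, 0) = -(a, 0) := (Set.ext_iff.mp hT (a, 0)).mpr rfl
    simpa using h
  refine ⟨⟨gradingInvolution K T, ⟨gradingInvolution_bkt t, fun x => ?_, ?_⟩, fun θ hθ => ?_⟩, key⟩
  · simp [gradingInvolution_apply]
  · let : Module ℚ (T ⊗[K] T) := Module.compHom _ (algebraMap ℚ K)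
    have := IsAddTorsionFree.of_module_rat (T ⊗[K] T)
    ext x
    simp [gradingInvolution_apply, Prod.ext_iff, self_eq_neg]
  · ext1 x
    exact key θ hθ x.1 x.2

end
end

section
/- Let T be a Leibniz triple system over a field K of characteristic 0 with universal Leibniz envelope U(T) and involutive automorphism θ determining T (θ(a + w) = −a + w for a ∈ T, w ∈ T ⊗ T). If f is an automorphism of the Leibniz algebra U(T) satisfying f ∘ θ = θ ∘ f, then f(T) ⊆ T and the restriction of f to T is an automorphism of the Leibniz triple system T. -/
open TensorProduct

noncomputable section

variable {K : Type*} [Field K] [CharZero K]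
variable {T : Type*} [AddCommGroup T] [Module K T]

/-- A linear endomorphism of `U(T)` commuting with `θ` maps `T` into `T`. -/
theorem snd_map_inl_eq_zero
    (φ : (T × (T ⊗[K] T)) →ₗ[K] (T × (T ⊗[K] T)))
    (hθ : ∀ x : T × (T ⊗[K] T), φ (-x.1, x.2) = (-(φ x).1, (φ x).2)) (a : T) :
    (φ (a, 0)).2 = 0 := by
  have h : (φ (-(a, 0))).2 = (φ (a, 0)).2 := by
    rw [Prod.neg_mk, neg_zero]
    have := congrArg Prod.snd (hθ (a, 0))
    exact this
  rw [map_neg, Prod.snd_neg] at h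
  have h2 : (2 : K) • (φ (a, 0)).2 = 0 := by
    rw [two_smul]
    nth_rewrite 1 [← h]
    exact neg_add_cancel _
  exact (smul_eq_zero.mp h2).resolve_left two_ne_zero

/-- If `f` is an automorphism of `U(T)` commuting with `θ` (where
`θ(a + w) = −a + w`), then `f(T) ⊆ T` and `f|_T` is an automorphism of `T`. -/
theorem automorphism_of_envelope_restricts
    (t : T →ₗ[K] T →ₗ[K] T →ₗ[K] T) (h1 : LTS1 t) (h2 : LTS2 t)
    (f : (T × (T ⊗[K] T)) ≃ₗ[K] (T × (T ⊗[K] T)))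
    (hf : ∀ x y, f (bkt t x y) = bkt t (f x) (f y))
    (hθ : ∀ x : T × (T ⊗[K] T), f (-x.1, x.2) = (-(f x).1, (f x).2)) :
    (∀ a : T, (f (a, 0)).2 = 0) ∧
    ∃ g : T ≃ₗ[K] T,
      (∀ a : T, f (a, 0) = (g a, 0)) ∧
      (∀ a b c : T, g (t a b c) = t (g a) (g b) (g c)) := by
  have hsymm : ∀ x : T × (T ⊗[K] T),
      f.symm (-x.1, x.2) = (-(f.symm x).1, (f.symm x).2) := fun x => by
    rw [LinearEquiv.symm_apply_eq, hθ, LinearEquiv.apply_symm_apply]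
  have hfT : ∀ a : T, f (a, 0) = ((f (a, 0)).1, 0) := fun a =>
    Prod.ext rfl (snd_map_inl_eq_zero f.toLinearMap hθ a)
  have hsT : ∀ a : T, f.symm (a, 0) = ((f.symm (a, 0)).1, 0) := fun a =>
    Prod.ext rfl (snd_map_inl_eq_zero f.symm.toLinearMap hsymm a)
  have hbkt : ∀ a b c : T, bkt t (bkt t (a, 0) (b, 0)) (c, 0) = (t a b c, 0) := fun a b c => by
    simp [bkt]
  let incl := LinearMap.inl K T (T ⊗[K] T)
  let proj := LinearMap.fst K T (T ⊗[K] T)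
  let g : T ≃ₗ[K] T := LinearEquiv.ofLinearMap
    (proj ∘ₗ f.toLinearMap ∘ₗ incl) (proj ∘ₗ f.symm.toLinearMap ∘ₗ incl)
    (LinearMap.ext fun a => by
      change (f ((f.symm (a, 0)).1, 0)).1 = a
      rw [← hsT, LinearEquiv.apply_symm_apply])
    (LinearMap.ext fun a => by
      change (f.symm ((f (a, 0)).1, 0)).1 = a
      rw [← hfT, LinearEquiv.symm_apply_apply])
  have hg : ∀ a : T, f (a, 0) = (g a, 0) := hfT
  refine ⟨fun a => congrArg Prod.snd (hfT a), g, hg, fun a b c => ?_⟩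
  have h := congrArg f (hbkt a b c)
  rw [hf, hf, hg, hg, hg, hg, hbkt] at h
  exact (congrArg Prod.fst h).symm

end
end

section
/- Let T be a Leibniz triple system over a field K of characteristic 0 with universal Leibniz envelope U(T) and involutive automorphism θ determining T. Let V be a θ-invariant subspace of U(T) which is an ideal of the Leibniz algebra U(T). Then V ∩ T is an ideal of T, V ∩ (T ⊗ T) is an ideal of T ⊗ T, and i(V ∩ T) ⊆ V ∩ (T ⊗ T) ⊆ j(V ∩ T); consequently 𝕀(V ∩ T) ⊆ V ⊆ 𝕁(V ∩ T). -/
open TensorProduct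

noncomputable section

variable {K : Type*} [Field K] [CharZero K]
variable {T : Type*} [AddCommGroup T] [Module K T]

section EvenIdeal

set_option linter.unusedSectionVars false

variable {t : T →ₗ[K] T →ₗ[K] T →ₗ[K] T} {V : Submodule K (T × (T ⊗[K] T))}

theorem mem_components_of_theta_invariant
    (hθV : ∀ x ∈ V, ((-x.1, x.2) : T × (T ⊗[K] T)) ∈ V)
    {v : T × (T ⊗[K] T)} (hv : v ∈ V) :
    ((v.1, 0) : T × (T ⊗[K] T)) ∈ V ∧ ((0, v.2) : T × (T ⊗[K] T)) ∈ V := by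
  have h0 : ((0, v.2) : T × (T ⊗[K] T)) ∈ V := by
    have h := V.smul_mem (2⁻¹ : K) (V.add_mem hv (hθV v hv))
    convert h using 1
    ext1
    · simp
    · simp only [Prod.smul_snd, Prod.snd_add, ← two_smul K v.2]
      rw [inv_smul_smul₀ two_ne_zero]
  refine ⟨?_, h0⟩
  have h := V.sub_mem hv h0
  convert h using 1
  ext1 <;> simp

theorem IsIdealU.tmul_mem_left (hV : IsIdealU t V) {x : T}
    (hx : ((x, 0) : T × (T ⊗[K] T)) ∈ V) (a : T) :
    ((0, x ⊗ₜ[K] a) : T × (T ⊗[K] T)) ∈ V := by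
  simpa [bkt] using (hV _ hx (a, 0)).1

theorem IsIdealU.tmul_mem_right (hV : IsIdealU t V) {x : T}
    (hx : ((x, 0) : T × (T ⊗[K] T)) ∈ V) (a : T) :
    ((0, a ⊗ₜ[K] x) : T × (T ⊗[K] T)) ∈ V := by
  simpa [bkt] using (hV _ hx (a, 0)).2

theorem IsIdealU.lift_mem (hV : IsIdealU t V) {w : T ⊗[K] T}
    (hw : ((0, w) : T × (T ⊗[K] T)) ∈ V) (a : T) :
    ((TensorProduct.lift t w a, 0) : T × (T ⊗[K] T)) ∈ V := by
  simpa [bkt] using (hV _ hw (a, 0)).1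

theorem IsIdealU.isIdealT_comap_inl (hV : IsIdealU t V) :
    IsIdealT t (Submodule.comap (LinearMap.inl K T (T ⊗[K] T)) V) := by
  intro x hx a b
  simp only [Submodule.mem_comap, LinearMap.inl_apply] at hx ⊢
  refine ⟨by simpa using hV.lift_mem (hV.tmul_mem_left hx a) b,
    by simpa using hV.lift_mem (hV.tmul_mem_right hx a) b, ?_⟩
  simpa [bkt] using (hV _ hx (0, a ⊗ₜ[K] b)).2

theorem IsIdealU.isIdealTT_comap_inr (hV : IsIdealU t V) :
    IsIdealTT t (Submodule.comap (LinearMap.inr K T (T ⊗[K] T)) V) := by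
  intro v hv w
  simp only [Submodule.mem_comap, LinearMap.inr_apply] at hv ⊢
  have hflip : (0 : T →ₗ[K] T →ₗ[K] T).flip = 0 := rfl
  exact ⟨by simpa [bkt, bktT, hflip] using (hV _ hv (0, w)).1,
    by simpa [bkt, bktT, hflip] using (hV _ hv (0, w)).2⟩

theorem IsIdealU.iI_le_comap_inr (hV : IsIdealU t V) :
    iI (Submodule.comap (LinearMap.inl K T (T ⊗[K] T)) V) ≤
      Submodule.comap (LinearMap.inr K T (T ⊗[K] T)) V := by
  refine Submodule.span_le.2 ?_
  rintro z (⟨x, hx, a, rfl⟩ | ⟨x, hx, a, rfl⟩)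
  · exact hV.tmul_mem_left hx a
  · exact hV.tmul_mem_right hx a

theorem IsIdealU.comap_inr_le_jI (hV : IsIdealU t V) :
    Submodule.comap (LinearMap.inr K T (T ⊗[K] T)) V ≤
      jI t (Submodule.comap (LinearMap.inl K T (T ⊗[K] T)) V) := by
  intro w hw
  refine Submodule.mem_iInf _ |>.2 fun a => ⟨hV.lift_mem hw a, ?_⟩
  simpa [bkt] using (hV _ hw (a, 0)).2

end EvenIdeal

/-- If `V` is a `θ`-invariant ideal of `U(T)`, then `V ∩ T` is an ideal of `T`,
`V ∩ (T ⊗ T)` is an ideal of `T ⊗ T`, and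
`i(V ∩ T) ⊆ V ∩ (T ⊗ T) ⊆ j(V ∩ T)`, hence `𝕀(V ∩ T) ⊆ V ⊆ 𝕁(V ∩ T)`. -/
theorem theta_invariant_ideal_decomposition
    (t : T →ₗ[K] T →ₗ[K] T →ₗ[K] T) (h1 : LTS1 t) (h2 : LTS2 t)
    (V : Submodule K (T × (T ⊗[K] T)))
    (hθV : ∀ x ∈ V, ((-x.1, x.2) : T × (T ⊗[K] T)) ∈ V)
    (hV : IsIdealU t V) :
    IsIdealT t (Submodule.comap (LinearMap.inl K T (T ⊗[K] T)) V) ∧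
    IsIdealTT t (Submodule.comap (LinearMap.inr K T (T ⊗[K] T)) V) ∧
    iI (Submodule.comap (LinearMap.inl K T (T ⊗[K] T)) V) ≤
      Submodule.comap (LinearMap.inr K T (T ⊗[K] T)) V ∧
    Submodule.comap (LinearMap.inr K T (T ⊗[K] T)) V ≤
      jI t (Submodule.comap (LinearMap.inl K T (T ⊗[K] T)) V) ∧
    IU (Submodule.comap (LinearMap.inl K T (T ⊗[K] T)) V) ≤ V ∧
    V ≤ JU t (Submodule.comap (LinearMap.inl K T (T ⊗[K] T)) V) := by
  refine ⟨hV.isIdealT_comap_inl, hV.isIdealTT_comap_inr, hV.iI_le_comap_inr,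
    hV.comap_inr_le_jI, ?_, ?_⟩
  · rintro ⟨x, w⟩ ⟨hx, hw⟩
    simpa using V.add_mem hx (hV.iI_le_comap_inr hw)
  · intro v hv
    obtain ⟨hx, hw⟩ := mem_components_of_theta_invariant hθV hv
    exact ⟨hx, hV.comap_inr_le_jI hw⟩

end
end

section
/- Let T be a Leibniz triple system over a field K of characteristic 0 and I an ideal of T. Define I^[0] = I and I^[n+1] = {T I^[n] I^[n]} + {I^[n] T I^[n]} + {I^[n] I^[n] T}. Then for every n, I^[n] is an ideal of T, and I = I^[0] ⊇ I^[1] ⊇ ⋯ ⊇ I^[n] ⊇ ⋯. -/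
open TensorProduct

noncomputable section

variable {K : Type*} [Field K] [CharZero K]
variable {T : Type*} [AddCommGroup T] [Module K T]

section DerivedStep

variable {F V : Type*} [Field F] [AddCommGroup V] [Module F V]
variable {t : V →ₗ[F] V →ₗ[F] V →ₗ[F] V} {J : Submodule F V}

/-- The subspace `{V J J} + {J V J} + {J J V}`. -/
def derStep (t : V →ₗ[F] V →ₗ[F] V →ₗ[F] V) (J : Submodule F V) : Submodule F V :=
  tspan t ⊤ J J ⊔ tspan t J ⊤ J ⊔ tspan t J J ⊤

theorem mem_derStep_right (a : V) {b c : V} (hb : b ∈ J) (hc : c ∈ J) :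
    t a b c ∈ derStep t J :=
  Submodule.mem_sup_left (Submodule.mem_sup_left
    (Submodule.subset_span ⟨a, Submodule.mem_top, b, hb, c, hc, rfl⟩))

theorem mem_derStep_outer (b : V) {a c : V} (ha : a ∈ J) (hc : c ∈ J) :
    t a b c ∈ derStep t J :=
  Submodule.mem_sup_left (Submodule.mem_sup_right
    (Submodule.subset_span ⟨a, ha, b, Submodule.mem_top, c, hc, rfl⟩))

theorem mem_derStep_left (c : V) {a b : V} (ha : a ∈ J) (hb : b ∈ J) :
    t a b c ∈ derStep t J :=
  Submodule.mem_sup_right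
    (Submodule.subset_span ⟨a, ha, b, hb, c, Submodule.mem_top, rfl⟩)

theorem derStep_le {P : Submodule F V}
    (hr : ∀ a, ∀ b ∈ J, ∀ c ∈ J, t a b c ∈ P)
    (ho : ∀ b, ∀ a ∈ J, ∀ c ∈ J, t a b c ∈ P)
    (hl : ∀ c, ∀ a ∈ J, ∀ b ∈ J, t a b c ∈ P) : derStep t J ≤ P := by
  refine sup_le (sup_le ?_ ?_) ?_ <;> refine Submodule.span_le.2 ?_
  · rintro _ ⟨a, -, b, hb, c, hc, rfl⟩
    exact hr a b hb c hc
  · rintro _ ⟨a, ha, b, -, c, hc, rfl⟩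
    exact ho b a ha c hc
  · rintro _ ⟨a, ha, b, hb, c, -, rfl⟩
    exact hl c a ha b hb

theorem derStep_le_self (hJ : IsIdealT t J) : derStep t J ≤ J :=
  derStep_le (fun a b hb c _ => (hJ b hb a c).2.1) (fun b a ha c _ => (hJ a ha b c).1)
    (fun c a ha b _ => (hJ a ha b c).1)

/-- If `J` is an ideal, then `{{V J J} V V}` and `{{J V J} V V}` lie in `derStep t J`. -/
theorem triple_mem_derStep_of_mem (h2 : LTS2 t) (hJ : IsIdealT t J) {a b c : V}
    (hab : a ∈ J ∨ b ∈ J) (hc : c ∈ J) (d e : V) : t (t a b c) d e ∈ derStep t J := by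
  have hJab (x : V) : t a b x ∈ J :=
    hab.elim (fun h => (hJ a h b x).1) (fun h => (hJ b h a x).2.1)
  have hcde : t c d e ∈ J := (hJ c hc d e).1
  have hout : t a b (t c d e) ∈ derStep t J :=
    hab.elim (fun h => mem_derStep_outer b h hcde) (fun h => mem_derStep_right a h hcde)
  have key : t (t a b c) d e =
      t a b (t c d e) + t (t a b d) c e + t (t a b e) c d - t (t a b e) d c := by
    rw [h2 a b c d e]; abel
  rw [key]
  exact sub_mem (add_mem (add_mem hout (mem_derStep_left e (hJab d) hc))
    (mem_derStep_left d (hJab e) hc)) (mem_derStep_outer d (hJab e) hc)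

/-- If `J` is an ideal, then `{{J J V} V V}` lies in `derStep t J`. -/
theorem triple_mem_derStep_of_mem_left (h1 : LTS1 t) (h2 : LTS2 t) (hJ : IsIdealT t J)
    {a b : V} (ha : a ∈ J) (hb : b ∈ J) (c d e : V) : t (t a b c) d e ∈ derStep t J := by
  have key : t (t a b c) d e =
      t a (t b c d) e + t (t a c b) d e + t (t a d b) c e - t (t a d c) b e := by
    rw [h1 a b c d e]; abel
  rw [key]
  exact sub_mem (add_mem (add_mem (mem_derStep_left e ha (hJ b hb c d).1)
    (triple_mem_derStep_of_mem h2 hJ (.inl ha) hb d e))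
    (triple_mem_derStep_of_mem h2 hJ (.inl ha) hb c e))
    (mem_derStep_left e (hJ a ha d c).1 hb)

theorem isIdealT_derStep (h1 : LTS1 t) (h2 : LTS2 t) (hJ : IsIdealT t J) :
    IsIdealT t (derStep t J) := by
  have hmid {x : V} (hx : x ∈ J) (u v : V) : t u x v ∈ J := (hJ x hx u v).2.1
  have hlast {x : V} (hx : x ∈ J) (u v : V) : t u v x ∈ J := (hJ x hx u v).2.2
  have left {x : V} (hx : x ∈ derStep t J) (d e : V) : t x d e ∈ derStep t J := by
    suffices derStep t J ≤ (derStep t J).comap ((t.flip d).flip e) from this hx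
    exact derStep_le
      (fun a b hb c hc => triple_mem_derStep_of_mem h2 hJ (.inr hb) hc d e)
      (fun b a ha c hc => triple_mem_derStep_of_mem h2 hJ (.inl ha) hc d e)
      (fun c a ha b hb => triple_mem_derStep_of_mem_left h1 h2 hJ ha hb c d e)
  intro x hx d e
  refine ⟨left hx d e, ?_, ?_⟩
  · suffices derStep t J ≤ (derStep t J).comap ((t d).flip e) from this hx
    refine derStep_le (fun a b hb c hc => ?_) (fun b a ha c hc => ?_)
      (fun c a ha b hb => ?_) <;>
    simp only [Submodule.mem_comap, LinearMap.flip_apply, h1 d a b c e]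
    · exact add_mem (sub_mem (sub_mem (mem_derStep_left e (hlast hb d a) hc)
        (mem_derStep_left e (hmid hb d a) hc)) (mem_derStep_left e (hmid hc d a) hb))
        (left (mem_derStep_right d hc hb) a e)
    · exact add_mem (sub_mem (sub_mem (mem_derStep_left e (hmid ha d b) hc)
        (mem_derStep_left e (hlast ha d b) hc)) (left (mem_derStep_right d hc ha) b e))
        (mem_derStep_left e (hmid hc d b) ha)
    · exact add_mem (sub_mem (sub_mem (left (mem_derStep_right d ha hb) c e)
        (left (mem_derStep_right d hb ha) c e)) (mem_derStep_left e (hlast ha d c) hb))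
        (mem_derStep_left e (hlast hb d c) ha)
  · suffices derStep t J ≤ (derStep t J).comap (t d e) from this hx
    refine derStep_le (fun a b hb c hc => ?_) (fun b a ha c hc => ?_)
      (fun c a ha b hb => ?_) <;>
    simp only [Submodule.mem_comap, h2 d e a b c]
    · exact add_mem (sub_mem (sub_mem (mem_derStep_right _ hb hc)
        (mem_derStep_outer a (hlast hb d e) hc)) (mem_derStep_outer a (hlast hc d e) hb))
        (mem_derStep_left a (hlast hc d e) hb)
    · exact add_mem (sub_mem (sub_mem (mem_derStep_outer b (hlast ha d e) hc)
        (mem_derStep_right _ ha hc)) (mem_derStep_left b (hlast hc d e) ha))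
        (mem_derStep_outer b (hlast hc d e) ha)
    · exact add_mem (sub_mem (sub_mem (mem_derStep_left c (hlast ha d e) hb)
        (mem_derStep_left c (hlast hb d e) ha)) (mem_derStep_right _ ha hb))
        (mem_derStep_right _ hb ha)

end DerivedStep

/-- For an ideal `I` of a Leibniz triple system `T`, each term `I^[n]` of the
derived series is an ideal of `T`, and the series is decreasing. -/
theorem derived_series_of_ideal
    (t : T →ₗ[K] T →ₗ[K] T →ₗ[K] T) (h1 : LTS1 t) (h2 : LTS2 t)
    (I : Submodule K T) (hI : IsIdealT t I) :
    ∀ n : ℕ, IsIdealT t (derT t I n) ∧ derT t I (n + 1) ≤ derT t I n := by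
  have ideal (n : ℕ) : IsIdealT t (derT t I n) := by
    induction n with
    | zero => exact hI
    | succ n ih => exact isIdealT_derStep h1 h2 ih
  exact fun n => ⟨ideal n, derStep_le_self (ideal n)⟩

end
end

section
/- Let T be a Leibniz triple system over a field K of characteristic 0. If I and J are solvable ideals of T, then I + J is a solvable ideal of T. Consequently, T has a unique maximal solvable ideal R(T), namely the sum of all solvable ideals of T. -/
open TensorProduct

noncomputable section

variable {K : Type*} [Field K] [CharZero K]
variable {T : Type*} [AddCommGroup T] [Module K T]

lemma tspan_mono (t : T →ₗ[K] T →ₗ[K] T →ₗ[K] T) {A A' B B' C C' : Submodule K T}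
    (hA : A ≤ A') (hB : B ≤ B') (hC : C ≤ C') : tspan t A B C ≤ tspan t A' B' C' := by
  refine Submodule.span_mono ?_
  rintro x ⟨a, ha, b, hb, c, hc, rfl⟩
  exact ⟨a, hA ha, b, hB hb, c, hC hc, rfl⟩

lemma tspan_le {t : T →ₗ[K] T →ₗ[K] T →ₗ[K] T} {A B C D : Submodule K T} :
    tspan t A B C ≤ D ↔ ∀ a ∈ A, ∀ b ∈ B, ∀ c ∈ C, t a b c ∈ D := by
  refine Submodule.span_le.trans ⟨fun h a ha b hb c hc => h ⟨a, ha, b, hb, c, hc, rfl⟩, ?_⟩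
  rintro h _ ⟨a, ha, b, hb, c, hc, rfl⟩
  exact h a ha b hb c hc

lemma mem_tspan {t : T →ₗ[K] T →ₗ[K] T →ₗ[K] T} {A B C : Submodule K T} {a b c : T}
    (ha : a ∈ A) (hb : b ∈ B) (hc : c ∈ C) : t a b c ∈ tspan t A B C :=
  tspan_le.1 le_rfl a ha b hb c hc

lemma derT_succ (t : T →ₗ[K] T →ₗ[K] T →ₗ[K] T) (I : Submodule K T) (n : ℕ) :
    derT t I (n + 1) = tspan t ⊤ (derT t I n) (derT t I n) ⊔
      tspan t (derT t I n) ⊤ (derT t I n) ⊔ tspan t (derT t I n) (derT t I n) ⊤ := rfl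

lemma derT_add_le (t : T →ₗ[K] T →ₗ[K] T →ₗ[K] T) {I J : Submodule K T} {n : ℕ}
    (h : derT t I n ≤ J) (m : ℕ) : derT t I (n + m) ≤ derT t J m := by
  induction m with
  | zero => exact h
  | succ m ih =>
    rw [← add_assoc, derT_succ, derT_succ]
    exact sup_le_sup (sup_le_sup (tspan_mono t le_rfl ih ih) (tspan_mono t ih le_rfl ih))
      (tspan_mono t ih ih le_rfl)

lemma derT_sup_le {t : T →ₗ[K] T →ₗ[K] T →ₗ[K] T} (I : Submodule K T) {J : Submodule K T}
    (hJ : IsIdealT t J) (n : ℕ) : derT t (I ⊔ J) n ≤ derT t I n ⊔ J := by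
  induction n with
  | zero => exact le_rfl
  | succ n ih =>
    have split : ∀ x ∈ derT t (I ⊔ J) n, ∃ y ∈ derT t I n, ∃ z ∈ J, y + z = x :=
      fun x hx => Submodule.mem_sup.1 (ih hx)
    rw [derT_succ t (I ⊔ J)]
    refine sup_le (sup_le ?_ ?_) ?_ <;> rw [tspan_le]
    · intro a ha b hb c hc
      obtain ⟨y, hy, z, hz, rfl⟩ := split b hb
      obtain ⟨y', hy', z', hz', rfl⟩ := split c hc
      refine Submodule.mem_sup.2 ⟨t a y y', ?_, t a y z' + t a z (y' + z'), ?_, ?_⟩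
      · exact Submodule.mem_sup_left (Submodule.mem_sup_left (mem_tspan ha hy hy'))
      · exact J.add_mem (hJ z' hz' a y).2.2 (hJ z hz a (y' + z')).2.1
      · simp only [map_add, LinearMap.add_apply]; abel
    · intro a ha b hb c hc
      obtain ⟨y, hy, z, hz, rfl⟩ := split a ha
      obtain ⟨y', hy', z', hz', rfl⟩ := split c hc
      refine Submodule.mem_sup.2 ⟨t y b y', ?_, t y b z' + t z b (y' + z'), ?_, ?_⟩
      · exact Submodule.mem_sup_left (Submodule.mem_sup_right (mem_tspan hy hb hy'))
      · exact J.add_mem (hJ z' hz' y b).2.2 (hJ z hz b (y' + z')).1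
      · simp only [map_add, LinearMap.add_apply]; abel
    · intro a ha b hb c hc
      obtain ⟨y, hy, z, hz, rfl⟩ := split a ha
      obtain ⟨y', hy', z', hz', rfl⟩ := split b hb
      refine Submodule.mem_sup.2 ⟨t y y' c, ?_, t y z' c + t z (y' + z') c, ?_, ?_⟩
      · exact Submodule.mem_sup_right (mem_tspan hy hy' hc)
      · exact J.add_mem (hJ z' hz' y c).2.1 (hJ z hz (y' + z') c).1
      · simp only [map_add, LinearMap.add_apply]; abel

lemma IsIdealT.sup {t : T →ₗ[K] T →ₗ[K] T →ₗ[K] T} {I J : Submodule K T}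
    (hI : IsIdealT t I) (hJ : IsIdealT t J) : IsIdealT t (I ⊔ J) := by
  intro x hx a b
  obtain ⟨y, hy, z, hz, rfl⟩ := Submodule.mem_sup.1 hx
  simp only [map_add, LinearMap.add_apply]
  exact ⟨Submodule.add_mem_sup (hI y hy a b).1 (hJ z hz a b).1,
    Submodule.add_mem_sup (hI y hy a b).2.1 (hJ z hz a b).2.1,
    Submodule.add_mem_sup (hI y hy a b).2.2 (hJ z hz a b).2.2⟩

lemma IsSolvT.sup {t : T →ₗ[K] T →ₗ[K] T →ₗ[K] T} {I J : Submodule K T}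
    (hI : IsSolvT t I) (hJ : IsIdealT t J) (hJ' : IsSolvT t J) : IsSolvT t (I ⊔ J) := by
  obtain ⟨n, hn⟩ := hI
  obtain ⟨m, hm⟩ := hJ'
  have h : derT t (I ⊔ J) n ≤ J := by simpa [hn] using derT_sup_le I hJ n
  exact ⟨n + m, le_bot_iff.1 (hm ▸ derT_add_le t h m)⟩

lemma isIdealT_bot (t : T →ₗ[K] T →ₗ[K] T →ₗ[K] T) : IsIdealT t ⊥ := by
  intro x hx a b
  simp [(Submodule.mem_bot K).1 hx]

/-- The sum of two solvable ideals of a Leibniz triple system is a solvable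
ideal; consequently the sum `R(T)` of all solvable ideals is the unique maximal
solvable ideal. -/
theorem solvable_radical_exists
    [FiniteDimensional K T]
    (t : T →ₗ[K] T →ₗ[K] T →ₗ[K] T) (h1 : LTS1 t) (h2 : LTS2 t) :
    (∀ I J : Submodule K T, IsIdealT t I → IsSolvT t I →
      IsIdealT t J → IsSolvT t J →
      IsIdealT t (I ⊔ J) ∧ IsSolvT t (I ⊔ J)) ∧
    (IsIdealT t (radT t) ∧ IsSolvT t (radT t) ∧
      ∀ S : Submodule K T, IsIdealT t S → IsSolvT t S → S ≤ radT t) := by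
  have hsup : ∀ I J : Submodule K T, IsIdealT t I → IsSolvT t I →
      IsIdealT t J → IsSolvT t J → IsIdealT t (I ⊔ J) ∧ IsSolvT t (I ⊔ J) :=
    fun I J hI hI' hJ hJ' => ⟨hI.sup hJ, hI'.sup hJ hJ'⟩
  have hrad : radT t ∈ {S : Submodule K T | IsIdealT t S ∧ IsSolvT t S} :=
    CompleteLattice.WellFoundedGT.isSupClosedCompact (Submodule K T) inferInstance _
      ⟨⊥, isIdealT_bot t, 0, rfl⟩ (fun I hI J hJ => hsup I J hI.1 hI.2 hJ.1 hJ.2)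
  exact ⟨hsup, hrad.1, hrad.2, fun S hS hS' => le_sSup ⟨hS, hS'⟩⟩

end
end

section
/- Let T be a Leibniz triple system over a field K of characteristic 0 and let Ker(T) be the subspace of T spanned by all elements {abc} − {acb} + {bca} with a, b, c ∈ T. Then: (1) Ker(T) is an ideal of T satisfying {T T Ker(T)} = {T Ker(T) T} = 0; (2) the quotient T/Ker(T) with the induced ternary product is a Lie triple system, and T itself is a Lie triple system if and only if Ker(T) = 0; (3) Ker(T)^[1] = 0, so Ker(T) is a solvable ideal and Ker(T) ⊆ R(T). -/
open TensorProduct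

noncomputable section

variable {K : Type*} [Field K] [CharZero K]
variable {T : Type*} [AddCommGroup T] [Module K T]

theorem kerT_generator_mem (t : T →ₗ[K] T →ₗ[K] T →ₗ[K] T) (a b c : T) :
    t a b c - t a c b + t b c a ∈ kerT t :=
  Submodule.subset_span ⟨a, b, c, rfl⟩

theorem right_kerT_eq_zero {t : T →ₗ[K] T →ₗ[K] T →ₗ[K] T} (h2 : LTS2 t) (a b : T) {x : T}
    (hx : x ∈ kerT t) : t a b x = 0 := by
  suffices h : kerT t ≤ LinearMap.ker (t a b) from h hx
  refine Submodule.span_le.2 ?_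
  rintro _ ⟨c, d, e, rfl⟩
  simp only [SetLike.mem_coe, LinearMap.mem_ker, map_add, map_sub, h2 a b]
  abel

theorem middle_kerT_eq_zero {t : T →ₗ[K] T →ₗ[K] T →ₗ[K] T} (h1 : LTS1 t) (a b : T) {x : T}
    (hx : x ∈ kerT t) : t a x b = 0 := by
  suffices h : kerT t ≤ LinearMap.ker ((t a).flip b) from h hx
  refine Submodule.span_le.2 ?_
  rintro _ ⟨c, d, e, rfl⟩
  simp only [SetLike.mem_coe, LinearMap.mem_ker, LinearMap.flip_apply, map_add, map_sub,
    h1 a]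
  abel

theorem left_kerT_mem {t : T →ₗ[K] T →ₗ[K] T →ₗ[K] T} (h1 : LTS1 t) (h2 : LTS2 t) (d e : T)
    {x : T} (hx : x ∈ kerT t) : t x d e ∈ kerT t := by
  suffices h : kerT t ≤ (kerT t).comap ((t.flip d).flip e) from h hx
  refine Submodule.span_le.2 ?_
  rintro _ ⟨a, b, c, rfl⟩
  have key := add_mem (add_mem (kerT_generator_mem t (t a d e) b c)
    (kerT_generator_mem t (t b c e) a d)) (add_mem (kerT_generator_mem t (t b c d) a e)
    (kerT_generator_mem t a (t b c d) e))
  simp only [SetLike.mem_coe, Submodule.mem_comap, LinearMap.flip_apply, map_add, map_sub]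
  convert key using 1
  simp only [h1 _ _ _ _ _, h2 _ _ _ _ _]
  abel

theorem isIdealT_kerT {t : T →ₗ[K] T →ₗ[K] T →ₗ[K] T} (h1 : LTS1 t) (h2 : LTS2 t) :
    IsIdealT t (kerT t) := fun _ hx a b =>
  ⟨left_kerT_mem h1 h2 a b hx, by simp [middle_kerT_eq_zero h1 a b hx],
    by simp [right_kerT_eq_zero h2 a b hx]⟩

theorem add_swap_mem_kerT (t : T →ₗ[K] T →ₗ[K] T →ₗ[K] T) (a b c : T) :
    t a b c + t b a c ∈ kerT t := by
  convert add_mem (kerT_generator_mem t c a b) (kerT_generator_mem t c b a) using 1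
  abel

theorem self_self_mem_kerT (t : T →ₗ[K] T →ₗ[K] T →ₗ[K] T) (a c : T) :
    t a a c ∈ kerT t := by
  simpa using kerT_generator_mem t c a a

theorem cyclic_mem_kerT (t : T →ₗ[K] T →ₗ[K] T →ₗ[K] T) (a b c : T) :
    t a b c + t b c a + t c a b ∈ kerT t := by
  convert add_mem (kerT_generator_mem t a b c) (add_swap_mem_kerT t a c b) using 1
  abel

theorem derivation_mem_kerT {t : T →ₗ[K] T →ₗ[K] T →ₗ[K] T} (h2 : LTS2 t) (a b c d e : T) :
    t a b (t c d e) - t (t a b c) d e - t c (t a b d) e - t c d (t a b e) ∈ kerT t := by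
  convert neg_mem (add_mem (add_swap_mem_kerT t (t a b d) c e)
    (kerT_generator_mem t (t a b e) c d)) using 1
  rw [h2 a b c d e]
  abel

theorem isLieTS_iff_kerT_eq_bot {t : T →ₗ[K] T →ₗ[K] T →ₗ[K] T} (h2 : LTS2 t) :
    IsLieTS t ↔ kerT t = ⊥ := by
  constructor
  · rintro ⟨hself, hcyc, -⟩
    refine Submodule.span_eq_bot.2 ?_
    rintro _ ⟨a, b, c, rfl⟩
    have hswap : t a c b + t c a b = 0 := by
      simpa [hself] using hself (a + c) b
    rw [← hcyc a b c, ← sub_eq_zero, ← neg_eq_zero, ← hswap]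
    abel
  · intro h
    refine ⟨fun a c => ?_, fun a b c => ?_, fun a b c d e => ?_⟩
    · simpa [h] using self_self_mem_kerT t a c
    · simpa [h] using cyclic_mem_kerT t a b c
    · have hder := derivation_mem_kerT h2 a b c d e
      rw [h, Submodule.mem_bot, sub_sub, sub_sub, sub_eq_zero] at hder
      rw [hder, add_assoc]

theorem derT_kerT_one {t : T →ₗ[K] T →ₗ[K] T →ₗ[K] T} (h1 : LTS1 t) (h2 : LTS2 t) :
    derT t (kerT t) 1 = ⊥ := by
  simp only [derT, derRel, tspan, sup_eq_bot_iff, Submodule.span_eq_bot]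
  refine ⟨⟨?_, ?_⟩, ?_⟩
  · rintro _ ⟨a, -, b, -, c, hc, rfl⟩
    exact right_kerT_eq_zero h2 a b hc
  · rintro _ ⟨a, -, b, -, c, hc, rfl⟩
    exact right_kerT_eq_zero h2 a b hc
  · rintro _ ⟨a, -, b, hb, c, -, rfl⟩
    exact middle_kerT_eq_zero h1 a c hb

/-- Properties of `Ker(T)`:
(1) it is an ideal with `{T T Ker(T)} = {T Ker(T) T} = 0`;
(2) the quotient `T/Ker(T)` is a Lie triple system (all Lie triple system
axioms hold modulo `Ker(T)`), and `T` itself is a Lie triple system iff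
`Ker(T) = 0`;
(3) `Ker(T)^[1] = 0`, so `Ker(T)` is solvable and `Ker(T) ⊆ R(T)`. -/
theorem kerT_properties
    (t : T →ₗ[K] T →ₗ[K] T →ₗ[K] T) (h1 : LTS1 t) (h2 : LTS2 t) :
    (IsIdealT t (kerT t) ∧
      (∀ a b : T, ∀ x ∈ kerT t, t a b x = 0 ∧ t a x b = 0)) ∧
    ((∀ a c : T, t a a c ∈ kerT t) ∧
      (∀ a b c : T, t a b c + t b c a + t c a b ∈ kerT t) ∧
      (∀ a b c d e : T,
        t a b (t c d e) - t (t a b c) d e - t c (t a b d) e - t c d (t a b e)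
          ∈ kerT t) ∧
      (IsLieTS t ↔ kerT t = ⊥)) ∧
    (derT t (kerT t) 1 = ⊥ ∧ IsSolvT t (kerT t) ∧ kerT t ≤ radT t) := by
  have hder := derT_kerT_one h1 h2
  have hideal := isIdealT_kerT h1 h2
  exact ⟨⟨hideal, fun a b _ hx => ⟨right_kerT_eq_zero h2 a b hx, middle_kerT_eq_zero h1 a b hx⟩⟩,
    ⟨self_self_mem_kerT t, cyclic_mem_kerT t, derivation_mem_kerT h2,
      isLieTS_iff_kerT_eq_bot h2⟩,
    hder, ⟨1, hder⟩, le_sSup ⟨hideal, 1, hder⟩⟩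

end
end
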